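/- arXiv:2307.10093 — 2 statements merged into one kernel-verified Lean document; each statement's English description precedes it below -/
import Mathlib

section
/- (Interpolation, α → 1.) For fixed data matrices X ∈ ℝ^{n×d}, Y ∈ ℝ^{m×d'}, fixed D_X ∈ ℝ^{n×n}, D_Y ∈ ℝ^{m×m}, and fixed probability vectors μ, ν, μ', ν', the function α ↦ AGW_α(X,Y) tends to GW(D_X,D_Y,μ,ν) as α → 1 within the interval [0,1]. -/
open Finset Matrix

/-- A probability vector: nonnegative entries summing to 1. -/
def IsProbVec {n : ℕ} (μ : Fin n → ℝ) : Prop :=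
  (∀ i, 0 ≤ μ i) ∧ ∑ i, μ i = 1

/-- The set of couplings Π(μ,ν): nonnegative matrices with row sums μ and column sums ν. -/
def Couplings {n m : ℕ} (μ : Fin n → ℝ) (ν : Fin m → ℝ) :
    Set (Matrix (Fin n) (Fin m) ℝ) :=
  {Γ | (∀ i j, 0 ≤ Γ i j) ∧ (∀ i, ∑ j, Γ i j = μ i) ∧ (∀ j, ∑ i, Γ i j = ν j)}

/-- The Gromov–Wasserstein loss of a coupling Γ. -/
def LGW {n m : ℕ} (DX : Matrix (Fin n) (Fin n) ℝ) (DY : Matrix (Fin m) (Fin m) ℝ)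
    (Γ : Matrix (Fin n) (Fin m) ℝ) : ℝ :=
  ∑ i, ∑ k, ∑ j, ∑ l, (DX i k - DY j l) ^ 2 * Γ i j * Γ k l

/-- The CO-Optimal Transport loss of a sample coupling Γs and a feature coupling Γv. -/
def LCOOT {n m d d' : ℕ} (X : Matrix (Fin n) (Fin d) ℝ) (Y : Matrix (Fin m) (Fin d') ℝ)
    (Γs : Matrix (Fin n) (Fin m) ℝ) (Γv : Matrix (Fin d) (Fin d') ℝ) : ℝ :=
  ∑ i, ∑ j, ∑ k, ∑ l, (X i k - Y j l) ^ 2 * Γs i j * Γv k l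

/-- The Gromov–Wasserstein value. -/
noncomputable def GWval {n m : ℕ} (DX : Matrix (Fin n) (Fin n) ℝ)
    (DY : Matrix (Fin m) (Fin m) ℝ) (μ : Fin n → ℝ) (ν : Fin m → ℝ) : ℝ :=
  sInf {v : ℝ | ∃ Γ ∈ Couplings μ ν, v = LGW DX DY Γ}

/-- The CO-Optimal Transport value. -/
noncomputable def COOTval {n m d d' : ℕ} (X : Matrix (Fin n) (Fin d) ℝ)
    (Y : Matrix (Fin m) (Fin d') ℝ) (μ : Fin n → ℝ) (ν : Fin m → ℝ)
    (μ' : Fin d → ℝ) (ν' : Fin d' → ℝ) : ℝ :=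
  sInf {v : ℝ | ∃ Γs ∈ Couplings μ ν, ∃ Γv ∈ Couplings μ' ν', v = LCOOT X Y Γs Γv}

/-- The augmented Gromov–Wasserstein value. -/
noncomputable def AGWval {n m d d' : ℕ} (α : ℝ) (X : Matrix (Fin n) (Fin d) ℝ)
    (Y : Matrix (Fin m) (Fin d') ℝ) (DX : Matrix (Fin n) (Fin n) ℝ)
    (DY : Matrix (Fin m) (Fin m) ℝ) (μ : Fin n → ℝ) (ν : Fin m → ℝ)
    (μ' : Fin d → ℝ) (ν' : Fin d' → ℝ) : ℝ :=
  sInf {v : ℝ | ∃ Γs ∈ Couplings μ ν, ∃ Γv ∈ Couplings μ' ν',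
    v = α * LGW DX DY Γs + (1 - α) * LCOOT X Y Γs Γv}

theorem coupling_nonempty {n m : ℕ} (μ : Fin n → ℝ) (ν : Fin m → ℝ)
    (hμ : IsProbVec μ) (hν : IsProbVec ν) : (Couplings μ ν).Nonempty := by
  refine ⟨fun i j => μ i * ν j, fun i j => mul_nonneg (hμ.1 i) (hν.1 j), fun i => ?_, fun j => ?_⟩
  · rw [← Finset.mul_sum, hν.2, mul_one]
  · rw [← Finset.sum_mul, hμ.2, one_mul]

theorem coupling_le_one {n m : ℕ} {μ : Fin n → ℝ} {ν : Fin m → ℝ}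
    (hμ : IsProbVec μ) {Γ : Matrix (Fin n) (Fin m) ℝ} (h : Γ ∈ Couplings μ ν)
    (i : Fin n) (j : Fin m) : Γ i j ≤ 1 := by
  have h1 : Γ i j ≤ μ i := by
    rw [← h.2.1 i]
    exact Finset.single_le_sum (f := fun j => Γ i j) (fun j _ => h.1 i j) (Finset.mem_univ j)
  have h2 : μ i ≤ 1 := by
    rw [← hμ.2]
    exact Finset.single_le_sum (f := μ) (fun j _ => hμ.1 j) (Finset.mem_univ i)
  exact h1.trans h2

theorem LGW_nonneg {n m : ℕ} (DX : Matrix (Fin n) (Fin n) ℝ) (DY : Matrix (Fin m) (Fin m) ℝ)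
    {Γ : Matrix (Fin n) (Fin m) ℝ} (h : ∀ i j, 0 ≤ Γ i j) : 0 ≤ LGW DX DY Γ := by
  unfold LGW
  refine Finset.sum_nonneg fun i _ => Finset.sum_nonneg fun k _ => Finset.sum_nonneg fun j _ =>
    Finset.sum_nonneg fun l _ => ?_
  exact mul_nonneg (mul_nonneg (sq_nonneg _) (h _ _)) (h _ _)

theorem LCOOT_nonneg {n m d d' : ℕ} (X : Matrix (Fin n) (Fin d) ℝ) (Y : Matrix (Fin m) (Fin d') ℝ)
    {Γs : Matrix (Fin n) (Fin m) ℝ} {Γv : Matrix (Fin d) (Fin d') ℝ}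
    (h : ∀ i j, 0 ≤ Γs i j) (h' : ∀ i j, 0 ≤ Γv i j) : 0 ≤ LCOOT X Y Γs Γv := by
  unfold LCOOT
  refine Finset.sum_nonneg fun i _ => Finset.sum_nonneg fun k _ => Finset.sum_nonneg fun j _ =>
    Finset.sum_nonneg fun l _ => ?_
  exact mul_nonneg (mul_nonneg (sq_nonneg _) (h _ _)) (h' _ _)

theorem LCOOT_le {n m d d' : ℕ} (X : Matrix (Fin n) (Fin d) ℝ) (Y : Matrix (Fin m) (Fin d') ℝ)
    {Γs : Matrix (Fin n) (Fin m) ℝ} {Γv : Matrix (Fin d) (Fin d') ℝ}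
    (h : ∀ i j, 0 ≤ Γs i j) (h' : ∀ i j, 0 ≤ Γv i j)
    (g : ∀ i j, Γs i j ≤ 1) (g' : ∀ i j, Γv i j ≤ 1) :
    LCOOT X Y Γs Γv ≤ ∑ i, ∑ j, ∑ k, ∑ l, (X i k - Y j l) ^ 2 := by
  unfold LCOOT
  refine Finset.sum_le_sum fun i _ => Finset.sum_le_sum fun j _ => Finset.sum_le_sum fun k _ =>
    Finset.sum_le_sum fun l _ => ?_
  have a := mul_le_of_le_one_right (sq_nonneg (X i k - Y j l)) (g i j)
  exact (mul_le_of_le_one_right (mul_nonneg (sq_nonneg _) (h _ _)) (g' _ _)).trans a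

theorem agw_tendsto_gw {n m d d' : ℕ}
    (X : Matrix (Fin n) (Fin d) ℝ) (Y : Matrix (Fin m) (Fin d') ℝ)
    (DX : Matrix (Fin n) (Fin n) ℝ) (DY : Matrix (Fin m) (Fin m) ℝ)
    (μ : Fin n → ℝ) (ν : Fin m → ℝ) (μ' : Fin d → ℝ) (ν' : Fin d' → ℝ)
    (hμ : IsProbVec μ) (hν : IsProbVec ν) (hμ' : IsProbVec μ') (hν' : IsProbVec ν') :
    Filter.Tendsto (fun α : ℝ => AGWval α X Y DX DY μ ν μ' ν')
      (nhdsWithin 1 (Set.Icc (0 : ℝ) 1)) (nhds (GWval DX DY μ ν)) := by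
  obtain ⟨Γ₀, hΓ₀⟩ := coupling_nonempty μ ν hμ hν
  obtain ⟨Γ₁, hΓ₁⟩ := coupling_nonempty μ' ν' hμ' hν'
  set C : ℝ := ∑ i, ∑ j, ∑ k, ∑ l, (X i k - Y j l) ^ 2
  have hbdd : BddBelow {v : ℝ | ∃ Γ ∈ Couplings μ ν, v = LGW DX DY Γ} := by
    refine ⟨0, ?_⟩
    rintro v ⟨Γ, hΓ, rfl⟩
    exact LGW_nonneg DX DY hΓ.1
  have hlow : Filter.Tendsto (fun α : ℝ => α * GWval DX DY μ ν)
      (nhdsWithin 1 (Set.Icc (0 : ℝ) 1)) (nhds (GWval DX DY μ ν)) := by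
    have : Continuous (fun α : ℝ => α * GWval DX DY μ ν) := by fun_prop
    simpa using (this.tendsto 1).mono_left nhdsWithin_le_nhds
  have hup : Filter.Tendsto (fun α : ℝ => GWval DX DY μ ν + (1 - α) * C)
      (nhdsWithin 1 (Set.Icc (0 : ℝ) 1)) (nhds (GWval DX DY μ ν)) := by
    have : Continuous (fun α : ℝ => GWval DX DY μ ν + (1 - α) * C) := by fun_prop
    simpa using (this.tendsto 1).mono_left nhdsWithin_le_nhds
  refine tendsto_of_tendsto_of_tendsto_of_le_of_le' hlow hup ?_ ?_
  · filter_upwards [self_mem_nhdsWithin] with α hα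
    refine le_csInf ⟨_, Γ₀, hΓ₀, Γ₁, hΓ₁, rfl⟩ ?_
    rintro v ⟨Γs, hs, Γv, hv, rfl⟩
    have h1 : GWval DX DY μ ν ≤ LGW DX DY Γs := csInf_le hbdd ⟨Γs, hs, rfl⟩
    have h2 := mul_le_mul_of_nonneg_left h1 hα.1
    have h3 := mul_nonneg (sub_nonneg.2 hα.2) (LCOOT_nonneg X Y hs.1 hv.1)
    linarith
  · filter_upwards [self_mem_nhdsWithin] with α hα
    rw [← sub_le_iff_le_add]
    refine le_csInf ⟨_, Γ₀, hΓ₀, rfl⟩ ?_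
    rintro v ⟨Γs, hs, rfl⟩
    have h0 := LGW_nonneg DX DY hs.1
    have h1 : AGWval α X Y DX DY μ ν μ' ν' ≤
        α * LGW DX DY Γs + (1 - α) * LCOOT X Y Γs Γ₁ := by
      refine csInf_le ⟨0, ?_⟩ ⟨Γs, hs, Γ₁, hΓ₁, rfl⟩
      rintro v ⟨Γs, hs, Γv, hv, rfl⟩
      exact add_nonneg (mul_nonneg hα.1 (LGW_nonneg DX DY hs.1))
        (mul_nonneg (sub_nonneg.2 hα.2) (LCOOT_nonneg X Y hs.1 hv.1))
    have h2 : LCOOT X Y Γs Γ₁ ≤ C := LCOOT_le X Y hs.1 hΓ₁.1 (coupling_le_one hμ hs)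
      (coupling_le_one hμ' hΓ₁)
    have h3 := mul_le_mul_of_nonneg_left h2 (sub_nonneg.2 hα.2)
    have h4 := mul_le_of_le_one_left h0 hα.2
    linarith
end

section
/- (AGW is weakly invariant to translation — preservation of optimal plans.) Under the setting of the AGW translation shift (same D_X, D_Y, translated data Y + c), a pair (Γs,Γv) ∈ Π(μ,ν) × Π(μ',ν') minimizes the AGW objective α·L_GW(Γs) + (1−α)·L_COOT(Γs,Γv; X, Y + c) if and only if it minimizes α·L_GW(Γs) + (1−α)·L_COOT(Γs,Γv; X, Y); that is, the objective functions differ by the constant (1−α)·(c² − 2c·(μᵀ X μ' − νᵀ Y ν')) uniformly over all feasible coupling pairs, so the optimal transport plans are preserved under translation. -/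
open Finset Matrix

theorem coot_shift_aux {n m d d' : ℕ}
    (X : Matrix (Fin n) (Fin d) ℝ) (Y : Matrix (Fin m) (Fin d') ℝ) (c : ℝ)
    (μ : Fin n → ℝ) (ν : Fin m → ℝ) (μ' : Fin d → ℝ) (ν' : Fin d' → ℝ)
    (hμ : IsProbVec μ) (hμ' : IsProbVec μ')
    (Γs : Matrix (Fin n) (Fin m) ℝ) (hs : Γs ∈ Couplings μ ν)
    (Γv : Matrix (Fin d) (Fin d') ℝ) (hv : Γv ∈ Couplings μ' ν') :
    LCOOT X (Matrix.of fun j l => Y j l + c) Γs Γv = LCOOT X Y Γs Γv + (c ^ 2 -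
      2 * c * ((∑ i, ∑ k, μ i * X i k * μ' k) - ∑ j, ∑ l, ν j * Y j l * ν' l)) := by
  obtain ⟨-, hs1, hs2⟩ := hs
  obtain ⟨-, hv1, hv2⟩ := hv
  have h1 : ∀ Z : Matrix (Fin n) (Fin d) ℝ,
      ∑ i, ∑ j, ∑ k, ∑ l, Z i k * Γs i j * Γv k l = ∑ i, ∑ k, μ i * Z i k * μ' k := by
    intro Z
    refine Finset.sum_congr rfl fun i _ => ?_
    rw [Finset.sum_comm]
    refine Finset.sum_congr rfl fun k _ => ?_
    simp_rw [← Finset.mul_sum, hv1, ← Finset.sum_mul, ← Finset.mul_sum, hs1]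
    ring
  have h2 : ∑ i, ∑ j, ∑ k, ∑ l, Y j l * Γs i j * Γv k l
      = ∑ j, ∑ l, ν j * Y j l * ν' l := by
    rw [Finset.sum_comm]
    refine Finset.sum_congr rfl fun j _ => ?_
    have : ∀ i, ∑ k, ∑ l, Y j l * Γs i j * Γv k l = ∑ l, Γs i j * (Y j l * ν' l) := by
      intro i
      rw [Finset.sum_comm]
      refine Finset.sum_congr rfl fun l _ => ?_
      rw [← Finset.mul_sum, hv2]
      ring
    simp_rw [this]
    rw [Finset.sum_comm]
    refine Finset.sum_congr rfl fun l _ => ?_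
    rw [← Finset.sum_mul, hs2]
    ring
  have h3 : ∑ i, ∑ j, ∑ k, ∑ l, (1 : ℝ) * Γs i j * Γv k l = 1 := by
    have h := h1 (Matrix.of fun _ _ => 1)
    simp only [Matrix.of_apply] at h
    rw [h]
    simp_rw [mul_one, ← Finset.mul_sum, hμ'.2, mul_one, hμ.2]
  rw [← h1 X, ← h2, ← mul_one (c ^ 2)]
  rw [← h3]
  unfold LCOOT
  simp only [Finset.mul_sum, ← Finset.sum_sub_distrib, ← Finset.sum_add_distrib]
  refine Finset.sum_congr rfl fun i _ => Finset.sum_congr rfl fun j _ =>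
    Finset.sum_congr rfl fun k _ => Finset.sum_congr rfl fun l _ => ?_
  simp only [Matrix.of_apply]
  ring

theorem agw_translation_preserves_optimal_plans {n m d d' : ℕ}
    (α : ℝ) (hα : α ∈ Set.Icc (0 : ℝ) 1)
    (X : Matrix (Fin n) (Fin d) ℝ) (Y : Matrix (Fin m) (Fin d') ℝ) (c : ℝ)
    (DX : Matrix (Fin n) (Fin n) ℝ) (DY : Matrix (Fin m) (Fin m) ℝ)
    (μ : Fin n → ℝ) (ν : Fin m → ℝ) (μ' : Fin d → ℝ) (ν' : Fin d' → ℝ)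
    (hμ : IsProbVec μ) (hν : IsProbVec ν) (hμ' : IsProbVec μ') (hν' : IsProbVec ν') :
    (∀ Γs ∈ Couplings μ ν, ∀ Γv ∈ Couplings μ' ν',
        α * LGW DX DY Γs + (1 - α) * LCOOT X (Matrix.of fun j l => Y j l + c) Γs Γv =
          α * LGW DX DY Γs + (1 - α) * LCOOT X Y Γs Γv +
            (1 - α) * (c ^ 2 -
              2 * c * ((∑ i, ∑ k, μ i * X i k * μ' k) - ∑ j, ∑ l, ν j * Y j l * ν' l))) ∧
    (∀ Γs ∈ Couplings μ ν, ∀ Γv ∈ Couplings μ' ν',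
        ((∀ Γ ∈ Couplings μ ν, ∀ Γ' ∈ Couplings μ' ν',
            α * LGW DX DY Γs + (1 - α) * LCOOT X (Matrix.of fun j l => Y j l + c) Γs Γv ≤
              α * LGW DX DY Γ + (1 - α) * LCOOT X (Matrix.of fun j l => Y j l + c) Γ Γ') ↔
          (∀ Γ ∈ Couplings μ ν, ∀ Γ' ∈ Couplings μ' ν',
            α * LGW DX DY Γs + (1 - α) * LCOOT X Y Γs Γv ≤
              α * LGW DX DY Γ + (1 - α) * LCOOT X Y Γ Γ'))) := by
  have key := fun Γs hs Γv hv =>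
    coot_shift_aux X Y c μ ν μ' ν' hμ hμ' Γs hs Γv hv
  refine ⟨fun Γs hs Γv hv => ?_, fun Γs hs Γv hv => ?_⟩
  · rw [key Γs hs Γv hv]
    ring
  · refine forall_congr' fun Γ => forall_congr' fun h => forall_congr' fun Γ' =>
      forall_congr' fun h' => ?_
    rw [key Γs hs Γv hv, key Γ h Γ' h', mul_add, mul_add, ← add_assoc, ← add_assoc]
    exact add_le_add_iff_right _
end
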